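/- arXiv:2109.11515 — 2 statements merged into one kernel-verified Lean document; each statement's English description precedes it below -/
import Mathlib

section
/- Let d, k be positive integers with k ≤ d and let δ ≥ 0. Let x, y ∈ ℝ^d be vectors such that x has at most k nonzero entries and ‖x − y‖_{2,k} ≤ δ. Let z ∈ ℝ^d be obtained from y by keeping a set of k entries of y of largest absolute value and setting all remaining entries to 0. Then ‖x − z‖₂ ≤ √5 · δ. -/
open Finset MeasureTheory

/-- Euclidean (`ℓ₂`) norm of a vector in `ℝ^d`. -/
noncomputable def norm2 {d : ℕ} (x : Fin d → ℝ) : ℝ :=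
  Real.sqrt (∑ i, (x i) ^ 2)

/-- The `(2,k)`-norm: max `ℓ₂` norm over `k` entries. -/
noncomputable def norm2k {d : ℕ} (k : ℕ) (x : Fin d → ℝ) : ℝ :=
  sSup {r : ℝ | ∃ S : Finset (Fin d), S.card = k ∧ r = Real.sqrt (∑ i ∈ S, (x i) ^ 2)}

/-- The `(F,k,k)`-norm: `‖A‖_{F,k,k}² = max_{|S|=k} Σ_{i∈S} ‖A_i‖_{2,k}²`. -/
noncomputable def normFkk {d : ℕ} (k : ℕ) (A : Matrix (Fin d) (Fin d) ℝ) : ℝ :=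
  Real.sqrt (sSup {r : ℝ | ∃ S : Finset (Fin d), S.card = k ∧
    r = ∑ i ∈ S, (norm2k k (A i)) ^ 2})

/-- The `(F,m)`-norm: max Frobenius norm over `m` entries of the matrix. -/
noncomputable def normFm {d : ℕ} (m : ℕ) (A : Matrix (Fin d) (Fin d) ℝ) : ℝ :=
  sSup {r : ℝ | ∃ Q : Finset (Fin d × Fin d), Q.card = m ∧
    r = Real.sqrt (∑ p ∈ Q, (A p.1 p.2) ^ 2)}

/-- Frobenius norm. -/
noncomputable def frobNorm {d : ℕ} (A : Matrix (Fin d) (Fin d) ℝ) : ℝ :=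
  Real.sqrt (∑ a, ∑ b, (A a b) ^ 2)

/-- Spectral norm (operator `ℓ₂ → ℓ₂` norm). -/
noncomputable def specNorm {d : ℕ} (A : Matrix (Fin d) (Fin d) ℝ) : ℝ :=
  sSup {r : ℝ | ∃ x : Fin d → ℝ, norm2 x = 1 ∧ r = norm2 (A.mulVec x)}

/-- Quadratic form `vᵀ A v`. -/
noncomputable def quadForm {d : ℕ} (A : Matrix (Fin d) (Fin d) ℝ) (v : Fin d → ℝ) : ℝ :=
  ∑ a, ∑ b, v a * A a b * v b

/-- Ky Fan 2-norm of a symmetric matrix: max of `|uᵀAu| + |vᵀAv|` over orthonormal pairs. -/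
noncomputable def kyFan2 {d : ℕ} (A : Matrix (Fin d) (Fin d) ℝ) : ℝ :=
  sSup {r : ℝ | ∃ u v : Fin d → ℝ, norm2 u = 1 ∧ norm2 v = 1 ∧ (∑ i, u i * v i) = 0 ∧
    r = |quadForm A u| + |quadForm A v|}

/-- `x` has at most `k` nonzero entries. -/
def sparseLE {d : ℕ} (k : ℕ) (x : Fin d → ℝ) : Prop :=
  ∃ S : Finset (Fin d), S.card ≤ k ∧ ∀ i, i ∉ S → x i = 0

/-- `A_Q`: the matrix equal to `A` on the entry set `Q` and zero elsewhere. -/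
def matRestrict {d : ℕ} (A : Matrix (Fin d) (Fin d) ℝ) (Q : Finset (Fin d × Fin d)) :
    Matrix (Fin d) (Fin d) ℝ :=
  Matrix.of fun a b => if (a, b) ∈ Q then A a b else 0

/-- `Δ_{n,ε}`. -/
def Delta (n : ℕ) (ε : ℝ) : Set (Fin n → ℝ) :=
  {w | (∑ i, w i) = 1 ∧ ∀ i, 0 ≤ w i ∧ w i ≤ 1 / ((1 - ε) * n)}

/-- Weighted empirical mean `μ_w`. -/
noncomputable def muW {n d : ℕ} (X : Fin n → Fin d → ℝ) (w : Fin n → ℝ) : Fin d → ℝ :=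
  fun j => ∑ i, w i * X i j

/-- Weighted empirical covariance `Σ_w`. -/
noncomputable def SigmaW {n d : ℕ} (X : Fin n → Fin d → ℝ) (w : Fin n → ℝ) :
    Matrix (Fin d) (Fin d) ℝ :=
  Matrix.of fun a b => ∑ i, w i * (X i a - muW X w a) * (X i b - muW X w b)

/-- Weighted second moment `M_w`. -/
noncomputable def MW {n d : ℕ} (X : Fin n → Fin d → ℝ) (w : Fin n → ℝ) :
    Matrix (Fin d) (Fin d) ℝ :=
  Matrix.of fun a b => ∑ i, w i * X i a * X i b

/-- `(k,ε,δ)`-stability for sparse mean estimation. -/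
def stableMean {n d : ℕ} (k : ℕ) (ε δ : ℝ) (X : Fin n → Fin d → ℝ) (μ : Fin d → ℝ) : Prop :=
  ∀ w ∈ Delta n (2 * ε),
    norm2k k (fun j => muW X w j - μ j) ≤ δ ∧ normFkk k (SigmaW X w - 1) ≤ δ ^ 2 / ε

/-- `(ε,δ)`-spectral stability for (non-sparse) mean estimation. -/
def stableSpec {n d : ℕ} (ε δ : ℝ) (X : Fin n → Fin d → ℝ) (μ : Fin d → ℝ) : Prop :=
  ∀ w ∈ Delta n (2 * ε),
    norm2 (fun j => muW X w j - μ j) ≤ δ ∧ specNorm (SigmaW X w - 1) ≤ δ ^ 2 / ε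

/-- `(k,ε,δ)`-stability for sparse PCA. -/
def stablePCA {n d : ℕ} (k : ℕ) (ε δ ρ : ℝ) (X : Fin n → Fin d → ℝ) (v : Fin d → ℝ) : Prop :=
  ∀ w ∈ Delta n (2 * ε),
    normFm (2 * k ^ 2) (MW X w - (1 + ρ • Matrix.vecMulVec v v)) ≤ δ

/-- `(ε,δ)`-KF2-stability for (non-sparse) PCA. -/
def stableKF2 {n d : ℕ} (ε δ ρ : ℝ) (X : Fin n → Fin d → ℝ) (v : Fin d → ℝ) : Prop :=
  ∀ w ∈ Delta n (2 * ε),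
    kyFan2 (MW X w - (1 + ρ • Matrix.vecMulVec v v)) ≤ δ

/-- `X` is an `ε`-corruption of `Xstar`: they differ in at most `εn` indices. -/
def isCorruption {n d : ℕ} (ε : ℝ) (X Xstar : Fin n → Fin d → ℝ) : Prop :=
  ∃ B : Finset (Fin n), (B.card : ℝ) ≤ ε * n ∧ ∀ i, i ∉ B → X i = Xstar i

/-- Uniform weight vector on a finite index set `G`. -/
noncomputable def uniformOn {n : ℕ} (G : Finset (Fin n)) : Fin n → ℝ :=
  fun i => if i ∈ G then ((G.card : ℝ))⁻¹ else 0

theorem Finset.sum_le_sum_of_card_eq_of_forall_le {ι : Type*} {A B : Finset ι} {f : ι → ℝ}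
    (hcard : A.card = B.card) (h : ∀ a ∈ A, ∀ b ∈ B, f a ≤ f b) :
    ∑ i ∈ A, f i ≤ ∑ i ∈ B, f i := by
  rcases A.eq_empty_or_nonempty with rfl | hA
  · rw [Finset.card_eq_zero.mp hcard.symm]
  · obtain ⟨m, hm, hmax⟩ := A.exists_max_image f hA
    calc ∑ i ∈ A, f i ≤ A.card • f m := Finset.sum_le_card_nsmul _ _ _ hmax
      _ = B.card • f m := by rw [hcard]
      _ ≤ ∑ i ∈ B, f i := Finset.card_nsmul_le_sum _ _ _ (h m hm)

theorem sqrt_sum_sq_le_norm2k {d : ℕ} (x : Fin d → ℝ) (S : Finset (Fin d)) :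
    Real.sqrt (∑ i ∈ S, (x i) ^ 2) ≤ norm2k S.card x := by
  refine le_csSup ⟨norm2 x, ?_⟩ ⟨S, rfl, rfl⟩
  rintro r ⟨U, -, rfl⟩
  exact Real.sqrt_le_sqrt (Finset.sum_le_univ_sum_of_nonneg fun i => sq_nonneg (x i))

theorem sum_sq_le_of_norm2k_le {d k : ℕ} {x : Fin d → ℝ} {δ : ℝ} (hδ : 0 ≤ δ)
    (h : norm2k k x ≤ δ) {S : Finset (Fin d)} (hS : S.card = k) :
    ∑ i ∈ S, (x i) ^ 2 ≤ δ ^ 2 := by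
  subst hS
  exact (Real.sqrt_le_left hδ).mp ((sqrt_sum_sq_le_norm2k x S).trans h)

/-- hard thresholding preserves closeness in `(2,k)`-norm. -/
theorem stmt0 {d k : ℕ} (hd : 0 < d) (hk : 0 < k) (hkd : k ≤ d)
    (δ : ℝ) (hδ : 0 ≤ δ) (x y z : Fin d → ℝ)
    (hx : sparseLE k x)
    (hxy : norm2k k (fun i => x i - y i) ≤ δ)
    (T : Finset (Fin d)) (hT : T.card = k)
    (hTmax : ∀ i ∈ T, ∀ j, j ∉ T → |y j| ≤ |y i|)
    (hz : z = fun i => if i ∈ T then y i else 0) :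
    norm2 (fun i => x i - z i) ≤ Real.sqrt 5 * δ := by
  obtain ⟨S₀, hS₀, hxS₀⟩ := hx
  obtain ⟨S, hS₀S, hS⟩ := Finset.exists_superset_card_eq hS₀ (by simpa using hkd)
  have hxS : ∀ i, i ∉ S → x i = 0 := fun i hi => hxS₀ i fun h => hi (hS₀S h)
  have hcard : (S \ T).card = (T \ S).card := Finset.card_sdiff_comm (hS.trans hT.symm)
  have hbS := sum_sq_le_of_norm2k_le hδ hxy hS
  have hbT := sum_sq_le_of_norm2k_le hδ hxy hT
  have hswap : ∑ i ∈ S \ T, y i ^ 2 ≤ ∑ i ∈ T \ S, y i ^ 2 := by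
    refine Finset.sum_le_sum_of_card_eq_of_forall_le hcard fun a ha b hb => ?_
    exact sq_le_sq.mpr
      (hTmax b (Finset.mem_sdiff.mp hb).1 a (Finset.mem_sdiff.mp ha).2)
  have hyB : ∑ i ∈ T \ S, y i ^ 2 = ∑ i ∈ T \ S, (x i - y i) ^ 2 := by
    refine Finset.sum_congr rfl fun i hi => ?_
    rw [hxS i (Finset.mem_sdiff.mp hi).2]
    ring
  have hyT : ∑ i ∈ T \ S, (x i - y i) ^ 2 ≤ ∑ i ∈ T, (x i - y i) ^ 2 :=
    Finset.sum_le_sum_of_subset_of_nonneg Finset.sdiff_subset fun _ _ _ => sq_nonneg _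
  have hyS : ∑ i ∈ S \ T, (x i - y i) ^ 2 ≤ ∑ i ∈ S, (x i - y i) ^ 2 :=
    Finset.sum_le_sum_of_subset_of_nonneg Finset.sdiff_subset fun _ _ _ => sq_nonneg _
  have hxA : ∑ i ∈ S \ T, x i ^ 2 ≤
      2 * ∑ i ∈ S \ T, (x i - y i) ^ 2 + 2 * ∑ i ∈ S \ T, y i ^ 2 := by
    rw [Finset.mul_sum, Finset.mul_sum, ← Finset.sum_add_distrib]
    exact Finset.sum_le_sum fun i _ => by nlinarith [sq_nonneg (x i - 2 * y i)]
  have hsplit : ∑ i, (x i - z i) ^ 2 =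
      ∑ i ∈ S \ T, x i ^ 2 + ∑ i ∈ T, (x i - y i) ^ 2 := by
    have hsub : ∑ i ∈ S \ T, x i ^ 2 = ∑ i ∈ Tᶜ, x i ^ 2 := by
      refine Finset.sum_subset (fun i hi => ?_) fun i hiT hi => ?_
      · exact Finset.mem_compl.mpr (Finset.mem_sdiff.mp hi).2
      · have hiS : i ∉ S := fun h =>
          hi (Finset.mem_sdiff.mpr ⟨h, Finset.mem_compl.mp hiT⟩)
        simp [hxS i hiS]
    rw [hsub, ← Finset.sum_compl_add_sum T]
    congr 1
    · refine Finset.sum_congr rfl fun i hi => ?_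
      simp [hz, Finset.mem_compl.mp hi]
    · refine Finset.sum_congr rfl fun i hi => ?_
      simp [hz, hi]
  calc norm2 (fun i => x i - z i) ≤ Real.sqrt (5 * δ ^ 2) :=
        Real.sqrt_le_sqrt (by linarith)
    _ = Real.sqrt 5 * δ := by rw [Real.sqrt_mul (by norm_num), Real.sqrt_sq hδ]
end

section
/- There exist universal constants ε₀ > 0 and C > 0 such that the following holds. Let G* = (Xᵢ*)ᵢ₌₁ⁿ be a set of n points in ℝ^d that is (k,ε,δ)-stable with respect to a vector μ ∈ ℝ^d, where 0 < ε ≤ min(δ, ε₀). Let S = (Xᵢ)ᵢ₌₁ⁿ be an ε-corruption of G*, let G ⊆ {1,…,n} be the set of unchanged indices (with |G| ≥ (1−ε)n), and let w* ∈ ℝⁿ be the uniform weight vector on G. Then for every w ∈ Δ_{n,ε}, computing μ_w and Σ_w from the corrupted samples S, we have ‖(μ_w − μ_{w*})(μ_w − μ_{w*})ᵀ‖_{F,k,k} ≤ 4ε·(‖Σ_w − I‖_{F,k,k} + C·δ²/ε). -/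
open Finset MeasureTheory

lemma le_norm2k {d k : ℕ} (x : Fin d → ℝ) {S : Finset (Fin d)} (hS : S.card = k) :
    Real.sqrt (∑ i ∈ S, (x i) ^ 2) ≤ norm2k k x := by
  refine le_csSup ?_ ⟨S, hS, rfl⟩
  refine ((Set.finite_range
    fun T : Finset (Fin d) => Real.sqrt (∑ i ∈ T, (x i) ^ 2)).subset ?_).bddAbove
  rintro r ⟨T, -, rfl⟩
  exact ⟨T, rfl⟩

lemma sum_sq_le_norm2k_sq {d k : ℕ} (x : Fin d → ℝ) {S : Finset (Fin d)} (hS : S.card = k) :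
    ∑ i ∈ S, (x i) ^ 2 ≤ norm2k k x ^ 2 :=
  (Real.sqrt_le_left ((Real.sqrt_nonneg _).trans (le_norm2k x hS))).1 (le_norm2k x hS)

lemma sqrt_sum_le_normFkk {d k : ℕ} (A : Matrix (Fin d) (Fin d) ℝ) {S : Finset (Fin d)}
    (hS : S.card = k) : Real.sqrt (∑ i ∈ S, (norm2k k (A i)) ^ 2) ≤ normFkk k A := by
  refine Real.sqrt_le_sqrt (le_csSup ?_ ⟨S, hS, rfl⟩)
  refine ((Set.finite_range
    fun T : Finset (Fin d) => ∑ i ∈ T, (norm2k k (A i)) ^ 2).subset ?_).bddAbove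
  rintro r ⟨T, -, rfl⟩
  exact ⟨T, rfl⟩

/-- A sparse unit vector pairs with `x` to at most the `(2,k)`-norm of `x`. -/
lemma abs_sum_mul_le_norm2k {d k : ℕ} (x v : Fin d → ℝ) {S : Finset (Fin d)}
    (hS : S.card = k) (hv : ∑ j ∈ S, (v j) ^ 2 = 1) :
    |∑ j ∈ S, v j * x j| ≤ norm2k k x := by
  refine le_trans (Real.abs_le_sqrt ?_) (le_norm2k x hS)
  simpa [hv] using sum_mul_sq_le_sq_mul_sq S v x

/-- The quadratic form of `A` at a sparse unit vector is at most the `(F,k,k)`-norm of `A`. -/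
lemma abs_sum_sum_mul_le_normFkk {d k : ℕ} (A : Matrix (Fin d) (Fin d) ℝ) (v : Fin d → ℝ)
    {S : Finset (Fin d)} (hS : S.card = k) (hv : ∑ j ∈ S, (v j) ^ 2 = 1) :
    |∑ a ∈ S, v a * ∑ b ∈ S, v b * A a b| ≤ normFkk k A := by
  refine le_trans (Real.abs_le_sqrt ?_) (sqrt_sum_le_normFkk A hS)
  refine (sum_mul_sq_le_sq_mul_sq S v _).trans ?_
  rw [hv, one_mul]
  refine sum_le_sum fun a _ => sq_le_sq' ?_ ?_
  · exact (abs_le.1 (abs_sum_mul_le_norm2k (A a) v hS hv)).1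
  · exact (abs_le.1 (abs_sum_mul_le_norm2k (A a) v hS hv)).2

lemma normFkk_vecMulVec_self_le {d k : ℕ} (u : Fin d → ℝ) {T : ℝ} (hT : 0 ≤ T)
    (h : ∀ S : Finset (Fin d), S.card = k → ∑ j ∈ S, (u j) ^ 2 ≤ T) :
    normFkk k (Matrix.vecMulVec u u) ≤ T := by
  have hrow (i : Fin d) : norm2k k (Matrix.vecMulVec u u i) ^ 2 ≤ (u i) ^ 2 * T := by
    have hnn : 0 ≤ (u i) ^ 2 * T := by positivity
    have h0 : 0 ≤ norm2k k (Matrix.vecMulVec u u i) := by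
      refine Real.sSup_nonneg ?_
      rintro r ⟨S, -, rfl⟩
      positivity
    refine (Real.le_sqrt h0 hnn).1 (Real.sSup_le ?_ (Real.sqrt_nonneg _))
    rintro r ⟨S, hS, rfl⟩
    refine Real.sqrt_le_sqrt ?_
    simp only [Matrix.vecMulVec_apply, mul_pow, ← mul_sum]
    exact mul_le_mul_of_nonneg_left (h S hS) (sq_nonneg _)
  refine Real.sqrt_le_iff.2 ⟨hT, Real.sSup_le ?_ (sq_nonneg T)⟩
  rintro r ⟨S, hS, rfl⟩
  calc ∑ i ∈ S, norm2k k (Matrix.vecMulVec u u i) ^ 2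
      ≤ ∑ i ∈ S, (u i) ^ 2 * T := sum_le_sum fun i _ => hrow i
    _ = (∑ i ∈ S, (u i) ^ 2) * T := by rw [sum_mul]
    _ ≤ T ^ 2 := by rw [sq]; exact mul_le_mul_of_nonneg_right (h S hS) hT

lemma sum_mul_muW {n d : ℕ} (X : Fin n → Fin d → ℝ) (w : Fin n → ℝ) (v : Fin d → ℝ)
    (S : Finset (Fin d)) :
    ∑ j ∈ S, v j * muW X w j = ∑ i, w i * ∑ j ∈ S, v j * X i j := by
  simp only [muW, mul_sum]
  rw [sum_comm]
  exact sum_congr rfl fun _ _ => sum_congr rfl fun _ _ => by ring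

/-- The quadratic form of `Σ_w - I` at a sparse unit vector is a projected variance minus one. -/
lemma sum_sum_mul_SigmaW_sub_one {n d : ℕ} (X : Fin n → Fin d → ℝ) (w : Fin n → ℝ)
    (v : Fin d → ℝ) {S : Finset (Fin d)} (hv : ∑ j ∈ S, (v j) ^ 2 = 1) :
    ∑ a ∈ S, v a * ∑ b ∈ S, v b * (SigmaW X w - 1) a b =
      ∑ i, w i * (∑ j ∈ S, v j * X i j - ∑ l, w l * ∑ j ∈ S, v j * X l j) ^ 2 - 1 := by
  have hone : ∑ a ∈ S, v a * ∑ b ∈ S, v b * (1 : Matrix (Fin d) (Fin d) ℝ) a b = 1 := by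
    rw [← hv]
    refine sum_congr rfl fun a ha => ?_
    simp [Matrix.one_apply, ha, sq]
  have hcov : ∑ a ∈ S, v a * ∑ b ∈ S, v b * SigmaW X w a b =
      ∑ i, w i * (∑ j ∈ S, v j * X i j - ∑ l, w l * ∑ j ∈ S, v j * X l j) ^ 2 := by
    have hcenter (i : Fin n) : ∑ j ∈ S, v j * X i j - ∑ l, w l * ∑ j ∈ S, v j * X l j =
        ∑ j ∈ S, v j * (X i j - muW X w j) := by
      rw [← sum_mul_muW, ← sum_sub_distrib]
      exact sum_congr rfl fun _ _ => by ring
    have hexpand (i : Fin n) : w i * (∑ j ∈ S, v j * (X i j - muW X w j)) ^ 2 =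
        ∑ a ∈ S, ∑ b ∈ S,
          v a * (v b * (w i * (X i a - muW X w a) * (X i b - muW X w b))) := by
      rw [sq, sum_mul_sum, mul_sum]
      refine sum_congr rfl fun a _ => ?_
      rw [mul_sum]
      exact sum_congr rfl fun _ _ => by ring
    simp only [hcenter, hexpand]
    symm
    rw [sum_comm]
    refine sum_congr rfl fun a _ => ?_
    rw [sum_comm]
    simp only [SigmaW, Matrix.of_apply, mul_sum, mul_assoc]
  simp only [Matrix.sub_apply, mul_sub, sum_sub_distrib]
  rw [hcov, hone]

/-- Restrict the weights `w` to `G` and renormalize. -/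
noncomputable def restrictWeight {n : ℕ} (G : Finset (Fin n)) (w : Fin n → ℝ) : Fin n → ℝ :=
  fun i => if i ∈ G then w i / ∑ l ∈ G, w l else 0

lemma sum_restrictWeight_mul {n : ℕ} (G : Finset (Fin n)) (w f : Fin n → ℝ) :
    ∑ i, restrictWeight G w i * f i = (∑ i ∈ G, w i * f i) / ∑ l ∈ G, w l := by
  simp only [restrictWeight, ite_mul, zero_mul, sum_ite_mem, univ_inter, sum_div]
  exact sum_congr rfl fun _ _ => by ring

/-- Passing to the weights restricted to `G` moves the mean by an amount controlled by
the excess variance of the removed mass. -/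
lemma mul_sq_mean_sub_le {n : ℕ} (G : Finset (Fin n)) (w y : Fin n → ℝ) (hw : ∀ i, 0 ≤ w i)
    (hsum : ∑ i, w i = 1) (hP : 0 < ∑ i ∈ G, w i) :
    (∑ i ∈ G, w i) * (∑ i, w i * y i - ∑ i, restrictWeight G w i * y i) ^ 2 ≤
      (1 - ∑ i ∈ G, w i) * (∑ i, w i * (y i - ∑ l, w l * y l) ^ 2 -
        (∑ i ∈ G, w i) * ∑ i, restrictWeight G w i *
          (y i - ∑ l, restrictWeight G w l * y l) ^ 2) := by
  have hB : ∑ i ∈ Gᶜ, w i = 1 - ∑ i ∈ G, w i := by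
    rw [← hsum, ← sum_add_sum_compl G w]; ring
  set m := ∑ i, w i * y i with hm
  set g := ∑ i, restrictWeight G w i * y i with hg
  rw [sum_restrictWeight_mul, mul_div_cancel₀ _ hP.ne']
  set P := ∑ i ∈ G, w i with hPdef
  have hgP : ∑ i ∈ G, w i * y i = P * g := by
    rw [hg, sum_restrictWeight_mul, mul_div_cancel₀ _ hP.ne']
  have hBy : ∑ i ∈ Gᶜ, w i * (y i - m) = P * (m - g) := by
    have h1 := sum_add_sum_compl G fun i => w i * y i
    simp only [mul_sub, sum_sub_distrib, ← sum_mul, hB]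
    rw [hgP, ← hm] at h1
    linarith
  have hCS : (P * (m - g)) ^ 2 ≤ (1 - P) * ∑ i ∈ Gᶜ, w i * (y i - m) ^ 2 := by
    rw [← hBy, ← hB]
    refine sum_sq_le_sum_mul_sum_of_sq_le_mul _ (fun i _ => hw i)
      (fun i _ => mul_nonneg (hw i) (sq_nonneg _)) fun i _ => le_of_eq (by ring)
  have hG : ∑ i ∈ G, w i * (y i - m) ^ 2 =
      ∑ i ∈ G, w i * (y i - g) ^ 2 + P * (m - g) ^ 2 := by
    have h (i : Fin n) : w i * (y i - m) ^ 2 =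
        w i * (y i - g) ^ 2 + (2 * (g - m) * (w i * y i) + w i * (m ^ 2 - g ^ 2)) := by ring
    simp only [h, sum_add_distrib, ← mul_sum, ← sum_mul, hgP, ← hPdef]
    ring
  have hsplit := sum_add_sum_compl G fun i => w i * (y i - m) ^ 2
  rw [← hsplit, hG]
  nlinarith

lemma restrictWeight_mem_Delta {n : ℕ} {ε : ℝ} {G : Finset (Fin n)} {w : Fin n → ℝ}
    (hn : 0 < (n : ℝ)) (hε : 2 * ε < 1) (hw : w ∈ Delta n ε)
    (hε1 : 0 < 1 - ε) (hP : 0 < ∑ i ∈ G, w i) (hPε : 1 - 2 * ε ≤ (1 - ε) * ∑ i ∈ G, w i) :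
    restrictWeight G w ∈ Delta n (2 * ε) := by
  refine ⟨?_, fun i => ?_⟩
  · have := sum_restrictWeight_mul G w fun _ => 1
    simpa [div_self hP.ne'] using this
  have hpos : 0 < (1 - 2 * ε) * n := mul_pos (by linarith) hn
  unfold restrictWeight
  split_ifs
  · refine ⟨div_nonneg (hw.2 i).1 hP.le, ?_⟩
    rw [div_le_div_iff₀ hP hpos, one_mul]
    have h1 := (le_div_iff₀ (mul_pos hε1 hn)).1 (hw.2 i).2
    calc w i * ((1 - 2 * ε) * n) ≤ w i * (((1 - ε) * ∑ i ∈ G, w i) * n) := by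
          have := (hw.2 i).1
          gcongr
      _ = (w i * ((1 - ε) * n)) * ∑ i ∈ G, w i := by ring
      _ ≤ 1 * ∑ i ∈ G, w i := by gcongr
      _ = _ := one_mul _
  · exact ⟨le_rfl, by positivity⟩

lemma uniformOn_mem_Delta {n : ℕ} {ε : ℝ} {G : Finset (Fin n)}
    (hG : 0 < (1 - ε) * n) (hcard : (1 - ε) * n ≤ (G.card : ℝ)) :
    uniformOn G ∈ Delta n ε := by
  have hpos : (0 : ℝ) < G.card := hG.trans_le hcard
  refine ⟨by simp [uniformOn, hpos.ne'], fun i => ?_⟩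
  unfold uniformOn
  split_ifs
  · exact ⟨by positivity, by rw [← one_div]; exact one_div_le_one_div_of_le hG hcard⟩
  · exact ⟨le_rfl, by positivity⟩

lemma one_sub_le_sum_mem_Delta {n : ℕ} {ε : ℝ} {G : Finset (Fin n)} {w : Fin n → ℝ}
    (hG : 0 < (1 - ε) * n) (hcard : (1 - ε) * n ≤ (G.card : ℝ)) (hn : 0 < (n : ℝ))
    (hw : w ∈ Delta n ε) : 1 - 2 * ε ≤ (1 - ε) * ∑ i ∈ G, w i := by
  have hB : ∑ i ∈ Gᶜ, w i ≤ (Gᶜ.card : ℝ) * (1 / ((1 - ε) * n)) := by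
    simpa using sum_le_card_nsmul Gᶜ w _ fun i _ => (hw.2 i).2
  have hc : (G.card : ℝ) + Gᶜ.card = n := by
    exact_mod_cast (card_add_card_compl G).trans (Fintype.card_fin n)
  have hs := (sum_add_sum_compl G w).trans hw.1
  rw [mul_one_div, le_div_iff₀ hG] at hB
  have hB' : (1 - ε) * (∑ i ∈ Gᶜ, w i) ≤ ε := by
    refine le_of_mul_le_mul_right ?_ hn
    linarith
  nlinarith

lemma cross_term_bound {ε δ D N P V VG m g a c : ℝ} (hε : 0 < ε) (hε₀ : ε ≤ 1 / 4)
    (hP : 0 < P) (hP1 : P ≤ 1) (hPε : 1 - 2 * ε ≤ (1 - ε) * P) (hD : ε ≤ D)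
    (hDδ : ε * D = δ ^ 2) (hN : 0 ≤ N)
    (hcross : P * (m - g) ^ 2 ≤ (1 - P) * (V - P * VG))
    (hvar : V - 1 ≤ N) (hvarG : -D ≤ VG - 1)
    (hg : -δ ≤ g - c ∧ g - c ≤ δ) (ha : -δ ≤ a - c ∧ a - c ≤ δ) :
    (m - a) ^ 2 ≤ 4 * ε * (N + 5 * D) := by
  have hβ : 1 - P ≤ 2 * ε * P := by nlinarith
  have hexc : V - P * VG ≤ N + 3 * D := by
    have h1 : P * (1 - D) ≤ P * VG := mul_le_mul_of_nonneg_left (by linarith) hP.le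
    nlinarith
  have hND : 0 ≤ N + 3 * D := by linarith
  have hmg : (m - g) ^ 2 ≤ 2 * ε * (N + 3 * D) := by
    refine le_of_mul_le_mul_left ?_ hP
    calc P * (m - g) ^ 2 ≤ (1 - P) * (V - P * VG) := hcross
      _ ≤ (1 - P) * (N + 3 * D) := mul_le_mul_of_nonneg_left hexc (by linarith)
      _ ≤ 2 * ε * P * (N + 3 * D) := mul_le_mul_of_nonneg_right hβ hND
      _ = P * (2 * ε * (N + 3 * D)) := by ring
  have hga : (g - a) ^ 2 ≤ (2 * δ) ^ 2 :=
    sq_le_sq' (by linarith [hg.1, ha.2]) (by linarith [hg.2, ha.1])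
  have hsq : (m - a) ^ 2 ≤ 2 * (m - g) ^ 2 + 2 * (g - a) ^ 2 := by
    nlinarith [sq_nonneg ((m - g) - (g - a))]
  nlinarith

/-- the cross term `(μ_w − μ_{w*})(μ_w − μ_{w*})ᵀ` is controlled by
`‖Σ_w − I‖_{F,k,k}` (Lemma on the rank-one cross term, sparse mean case). -/
theorem stmt4 :
    ∃ ε₀ > (0:ℝ), ∃ C > (0:ℝ),
      ∀ (n d k : ℕ) (ε δ : ℝ) (μ : Fin d → ℝ) (Xstar X : Fin n → Fin d → ℝ)
        (G : Finset (Fin n)) (wstar : Fin n → ℝ),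
        0 < ε → ε ≤ δ → ε ≤ ε₀ →
        stableMean k ε δ Xstar μ →
        isCorruption ε X Xstar →
        (∀ i ∈ G, X i = Xstar i) →
        (1 - ε) * n ≤ (G.card : ℝ) →
        wstar = uniformOn G →
        ∀ w ∈ Delta n ε,
          normFkk k (Matrix.vecMulVec (fun j => muW X w j - muW X wstar j)
              (fun j => muW X w j - muW X wstar j))
            ≤ 4 * ε * (normFkk k (SigmaW X w - 1) + C * δ ^ 2 / ε) := by
  refine ⟨1 / 4, by norm_num, 5, by norm_num, ?_⟩
  rintro n d k ε δ μ Xstar X G wstar hε hεδ hε₀ hstable - hXG hcard rfl w hw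
  have hn : 0 < (n : ℝ) := by
    rcases Nat.eq_zero_or_pos n with rfl | h
    · simpa using hw.1
    · exact_mod_cast h
  have hε1 : 0 < 1 - ε := by linarith
  have hG : 0 < (1 - ε) * n := mul_pos hε1 hn
  have hPε := one_sub_le_sum_mem_Delta hG hcard hn hw
  have hP : 0 < ∑ i ∈ G, w i := by nlinarith
  have hw' := restrictWeight_mem_Delta hn (by linarith) hw hε1 hP hPε
  have hu : uniformOn G ∈ Delta n (2 * ε) :=
    uniformOn_mem_Delta (mul_pos (by linarith) hn) (by nlinarith)
  have hP1 : ∑ i ∈ G, w i ≤ 1 := by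
    rw [← hw.1]
    exact sum_le_univ_sum_of_nonneg fun i => (hw.2 i).1
  have hD : ε ≤ δ ^ 2 / ε := by rw [le_div_iff₀ hε]; nlinarith
  have hDδ : ε * (δ ^ 2 / ε) = δ ^ 2 := mul_div_cancel₀ _ hε.ne'
  have hN : 0 ≤ normFkk k (SigmaW X w - 1) := Real.sqrt_nonneg _
  refine normFkk_vecMulVec_self_le _ (by rw [mul_div_assoc]; positivity) fun S hS => ?_
  set u : Fin d → ℝ := fun j => muW X w j - muW X (uniformOn G) j with hu_def
  rcases (sum_nonneg fun j (_ : j ∈ S) => sq_nonneg (u j)).eq_or_lt with hs | hs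
  · rw [← hs, mul_div_assoc]; positivity
  set s := ∑ j ∈ S, u j ^ 2 with hs_def
  set v : Fin d → ℝ := fun j => u j / Real.sqrt s with hv_def
  have hsq : Real.sqrt s ^ 2 = s := Real.sq_sqrt hs.le
  have hv : ∑ j ∈ S, (v j) ^ 2 = 1 := by
    simp only [hv_def, div_pow, ← sum_div, hsq, ← hs_def, div_self hs.ne']
  have hvu : (∑ j ∈ S, v j * u j) ^ 2 = s := by
    have : ∑ j ∈ S, v j * u j = s / Real.sqrt s := by
      rw [hs_def, sum_div]
      exact sum_congr rfl fun _ _ => by simp only [hv_def]; ring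
    rw [this, Real.div_sqrt, hsq]
  have hproj : ∑ j ∈ S, v j * u j = ∑ i, w i * (∑ j ∈ S, v j * X i j) -
      ∑ i, uniformOn G i * (∑ j ∈ S, v j * X i j) := by
    simp only [hu_def, mul_sub, sum_sub_distrib, sum_mul_muW]
  have hmean {q : Fin n → ℝ} (hq : q ∈ Delta n (2 * ε)) (hqG : ∀ i ∉ G, q i = 0) :
      |∑ i, q i * (∑ j ∈ S, v j * X i j) - ∑ j ∈ S, v j * μ j| ≤ δ := by
    have hX : ∑ i, q i * (∑ j ∈ S, v j * X i j) = ∑ i, q i * (∑ j ∈ S, v j * Xstar i j) := by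
      refine sum_congr rfl fun i _ => ?_
      by_cases hi : i ∈ G
      · rw [hXG i hi]
      · simp [hqG i hi]
    rw [hX, ← sum_mul_muW, ← sum_sub_distrib]
    simp only [← mul_sub]
    exact (abs_sum_mul_le_norm2k _ v hS hv).trans (hstable q hq).1
  have hrG : ∀ i ∉ G, restrictWeight G w i = 0 := fun i hi => by simp [restrictWeight, hi]
  have hmean1 := abs_le.1 (hmean hw' hrG)
  have hmean2 := abs_le.1 (hmean hu fun i hi => by simp [uniformOn, hi])
  have hvarG := (abs_sum_sum_mul_le_normFkk _ v hS hv).trans (hstable _ hw').2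
  have hvar := abs_sum_sum_mul_le_normFkk (SigmaW X w - 1) v hS hv
  have hcross := mul_sq_mean_sub_le G w (fun i => ∑ j ∈ S, v j * X i j)
    (fun i => (hw.2 i).1) hw.1 hP
  rw [sum_sum_mul_SigmaW_sub_one _ _ _ hv] at hvarG hvar
  have hVeq : ∑ i, restrictWeight G w i * (∑ j ∈ S, v j * Xstar i j -
        ∑ l, restrictWeight G w l * ∑ j ∈ S, v j * Xstar l j) ^ 2 =
      ∑ i, restrictWeight G w i * (∑ j ∈ S, v j * X i j -
        ∑ l, restrictWeight G w l * ∑ j ∈ S, v j * X l j) ^ 2 := by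
    simp only [sum_restrictWeight_mul]
    have h : ∑ i ∈ G, w i * ∑ j ∈ S, v j * Xstar i j = ∑ i ∈ G, w i * ∑ j ∈ S, v j * X i j :=
      sum_congr rfl fun i hi => by rw [hXG i hi]
    rw [h]
    congr 1
    exact sum_congr rfl fun i hi => by rw [hXG i hi]
  rw [hVeq] at hvarG
  have hvarG := (abs_le.1 hvarG).1
  have hvar := (abs_le.1 hvar).2
  rw [← hvu, hproj, mul_div_assoc]
  simp only at hcross
  generalize (∑ i, w i * (∑ j ∈ S, v j * X i j - ∑ l, w l * ∑ j ∈ S, v j * X l j) ^ 2) = V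
    at hcross hvar
  generalize (∑ i, restrictWeight G w i * (∑ j ∈ S, v j * X i j -
        ∑ l, restrictWeight G w l * ∑ j ∈ S, v j * X l j) ^ 2) = VG at hcross hvarG
  exact cross_term_bound hε hε₀ hP hP1 hPε hD hDδ hN hcross hvar hvarG hmean1 hmean2
end
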